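/- A graph G is a proper interval graph if and only if G contains no induced cycle of length at least four, no induced claw, no induced net, and no induced tent. -/

import Mathlib

/-- A graph is a proper interval graph if it is isomorphic to the intersection graph
of an inclusion-free family of closed intervals on the real line: distinct vertices
are adjacent iff their intervals intersect. -/
def IsProperIntervalGraph {V : Type*} (G : SimpleGraph V) : Prop :=
  ∃ f : V → ℝ × ℝ, (∀ v, (f v).1 ≤ (f v).2) ∧
    (∀ u v : V, ¬ Set.Icc (f u).1 (f u).2 ⊂ Set.Icc (f v).1 (f v).2) ∧
    (∀ u v : V, G.Adj u v ↔
      u ≠ v ∧ (Set.Icc (f u).1 (f u).2 ∩ Set.Icc (f v).1 (f v).2).Nonempty)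

/-- `G` has an induced cycle of length at least 4. -/
def HasInducedLongCycle {V : Type*} (G : SimpleGraph V) : Prop :=
  ∃ (m : ℕ), 4 ≤ m ∧ ∃ f : ZMod m → V, Function.Injective f ∧
    ∀ i j : ZMod m, G.Adj (f i) (f j) ↔ (j = i + 1 ∨ i = j + 1)

/-- `G` has an induced claw `K_{1,3}`. -/
def HasInducedClaw {V : Type*} (G : SimpleGraph V) : Prop :=
  ∃ y x₁ x₂ x₃ : V, x₁ ≠ x₂ ∧ x₁ ≠ x₃ ∧ x₂ ≠ x₃ ∧
    G.Adj y x₁ ∧ G.Adj y x₂ ∧ G.Adj y x₃ ∧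
    ¬ G.Adj x₁ x₂ ∧ ¬ G.Adj x₁ x₃ ∧ ¬ G.Adj x₂ x₃

/-- `G` has an induced net: a triangle `x₁x₂x₃` with pendant vertices `y₁,y₂,y₃`. -/
def HasInducedNet {V : Type*} (G : SimpleGraph V) : Prop :=
  ∃ x₁ x₂ x₃ y₁ y₂ y₃ : V, ([x₁, x₂, x₃, y₁, y₂, y₃] : List V).Nodup ∧
    G.Adj x₁ x₂ ∧ G.Adj x₂ x₃ ∧ G.Adj x₃ x₁ ∧
    G.Adj y₁ x₁ ∧ G.Adj y₂ x₂ ∧ G.Adj y₃ x₃ ∧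
    ¬ G.Adj y₁ x₂ ∧ ¬ G.Adj y₁ x₃ ∧ ¬ G.Adj y₂ x₁ ∧ ¬ G.Adj y₂ x₃ ∧
    ¬ G.Adj y₃ x₁ ∧ ¬ G.Adj y₃ x₂ ∧
    ¬ G.Adj y₁ y₂ ∧ ¬ G.Adj y₁ y₃ ∧ ¬ G.Adj y₂ y₃

/-- `G` has an induced tent: a triangle `x₁x₂x₃` with `yᵢ` adjacent to the two `xⱼ`,
`j ≠ i`, and the `yᵢ` pairwise non-adjacent. -/
def HasInducedTent {V : Type*} (G : SimpleGraph V) : Prop :=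
  ∃ x₁ x₂ x₃ y₁ y₂ y₃ : V, ([x₁, x₂, x₃, y₁, y₂, y₃] : List V).Nodup ∧
    G.Adj x₁ x₂ ∧ G.Adj x₂ x₃ ∧ G.Adj x₃ x₁ ∧
    G.Adj y₁ x₂ ∧ G.Adj y₁ x₃ ∧ G.Adj y₂ x₁ ∧ G.Adj y₂ x₃ ∧
    G.Adj y₃ x₁ ∧ G.Adj y₃ x₂ ∧
    ¬ G.Adj y₁ x₁ ∧ ¬ G.Adj y₂ x₂ ∧ ¬ G.Adj y₃ x₃ ∧
    ¬ G.Adj y₁ y₂ ∧ ¬ G.Adj y₁ y₃ ∧ ¬ G.Adj y₂ y₃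

theorem pig_forward {V : Type*} (G : SimpleGraph V) (h : IsProperIntervalGraph G) :
    ¬ HasInducedLongCycle G ∧ ¬ HasInducedClaw G ∧ ¬ HasInducedNet G ∧
      ¬ HasInducedTent G := by
  obtain ⟨f, hf, hs, ha⟩ := h
  obtain ⟨l, hl⟩ : ∃ l : V → ℝ, ∀ v, l v = (f v).1 := ⟨_, fun _ => rfl⟩
  obtain ⟨r, hr⟩ : ∃ r : V → ℝ, ∀ v, r v = (f v).2 := ⟨_, fun _ => rfl⟩
  simp only [← hl, ← hr] at hf hs ha
  have hadj : ∀ u v, G.Adj u v ↔ u ≠ v ∧ l u ≤ r v ∧ l v ≤ r u := by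
    intro u v
    rw [ha]
    refine and_congr_right fun _ => ?_
    rw [Set.Icc_inter_Icc, Set.nonempty_Icc]
    have := hf u
    have := hf v
    simp only [sup_le_iff, le_inf_iff]
    tauto
  have hsub : ∀ u v, l v ≤ l u → r u ≤ r v → l u ≤ l v ∧ r v ≤ r u := by
    intro u v h1 h2
    have h3 := hs u v
    rw [Set.ssubset_def] at h3
    have h4 : Set.Icc (l u) (r u) ⊆ Set.Icc (l v) (r v) := Set.Icc_subset_Icc h1 h2
    by_contra h5
    exact h3 ⟨h4, fun h6 => h5 ((Set.Icc_subset_Icc_iff (hf v)).1 h6)⟩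
  have hmono : ∀ u v, l u ≤ l v → r u ≤ r v := by
    intro u v h1
    by_contra h2
    have := hsub v u h1 (by linarith)
    linarith
  clear hs ha
  refine ⟨?_, ?_, ?_, ?_⟩
  · rintro ⟨m, hm, g, hg, hc⟩
    have : NeZero m := ⟨by omega⟩
    obtain ⟨i, hi⟩ := Finite.exists_min (fun i => l (g i))
    have h1 := (hadj _ _).1 ((hc i (i+1)).2 (Or.inl rfl))
    have h2 := (hadj _ _).1 ((hc i (i-1)).2 (Or.inr (by ring)))
    have m1 := hmono _ _ (hi (i+1))
    have m2 := hmono _ _ (hi (i-1))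
    have two : ((2:ℕ) : ZMod m) ≠ 0 := by
      rw [Ne, ZMod.natCast_eq_zero_iff]
      intro h; have := Nat.le_of_dvd (by norm_num) h; omega
    have three : ((3:ℕ) : ZMod m) ≠ 0 := by
      rw [Ne, ZMod.natCast_eq_zero_iff]
      intro h; have := Nat.le_of_dvd (by norm_num) h; omega
    have one : ((1:ℕ) : ZMod m) ≠ 0 := by
      rw [Ne, ZMod.natCast_eq_zero_iff]
      intro h; have := Nat.le_of_dvd (by norm_num) h; omega
    have hne : g (i+1) ≠ g (i-1) := by
      intro h
      apply two
      have := hg h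
      push_cast
      linear_combination this
    have h3 := (hadj _ _).2 ⟨hne, by linarith, by linarith⟩
    rcases (hc _ _).1 h3 with h | h
    · apply three
      push_cast
      linear_combination -h
    · apply one
      push_cast
      linear_combination h
  · rintro ⟨y, a, b, c, n1, n2, n3, h1, h2, h3, h4, h5, h6⟩
    have := hmono a y
    have := hmono b y
    have := hmono c y
    have := hmono y a
    have := hmono y b
    have := hmono y c
    have := hf a
    have := hf b
    have := hf c
    grind
  · rintro ⟨x1, x2, x3, y1, y2, y3, hn, h⟩
    simp only [List.nodup_cons, List.mem_cons, List.not_mem_nil, not_or] at hn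
    have := hf y1
    have := hf y2
    have := hf y3
    simp only [hadj] at h
    grind
  · rintro ⟨x1, x2, x3, y1, y2, y3, hn, h⟩
    simp only [List.nodup_cons, List.mem_cons, List.not_mem_nil, not_or] at hn
    have := hf y1
    have := hf y2
    have := hf y3
    simp only [hadj] at h
    grind

theorem pig_of_order {V : Type*} [Fintype V] (G : SimpleGraph V) (pos : V → ℕ)
    (hinj : Function.Injective pos)
    (humb : ∀ u v w, pos u < pos v → pos v < pos w → G.Adj u w → G.Adj u v ∧ G.Adj v w) :
    IsProperIntervalGraph G := by
  classical
  have hr : ∀ u, ∃ w, (w = u ∨ G.Adj u w) ∧ ∀ x, (x = u ∨ G.Adj u x) → pos x ≤ pos w := by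
    intro u
    obtain ⟨w, hw, hm⟩ := Finset.exists_max_image
      (Finset.univ.filter fun w => w = u ∨ G.Adj u w) pos ⟨u, by simp⟩
    exact ⟨w, by simpa using hw, fun x hx => hm x (by simpa using hx)⟩
  choose R hR1 hR2 using hr
  obtain ⟨N, hN⟩ : ∃ N : ℕ, ∀ v, pos v < N := by
    obtain ⟨N, hN⟩ := (Set.finite_range pos).bddAbove
    exact ⟨N + 1, fun v => Nat.lt_succ_of_le (hN ⟨v, rfl⟩)⟩
  obtain ⟨ε, hε⟩ : ∃ ε : V → ℝ, ∀ v, ε v = (pos v : ℝ) / N := ⟨_, fun _ => rfl⟩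
  have e0 : ∀ v, 0 ≤ ε v := fun v => by rw [hε]; positivity
  have e1 : ∀ v, ε v < 1 := fun v => by
    rw [hε, div_lt_one]
    · exact_mod_cast hN v
    · exact_mod_cast (Nat.zero_le _).trans_lt (hN v)
  have e2 : ∀ u v, pos u < pos v → ε u < ε v := fun u v h => by
    rw [hε, hε]
    apply div_lt_div_of_pos_right
    · exact_mod_cast h
    · exact_mod_cast (Nat.zero_le _).trans_lt (hN v)
  have hself : ∀ u, pos u ≤ pos (R u) := fun u => hR2 u u (Or.inl rfl)
  have hRm : ∀ u v, pos u < pos v → pos (R u) ≤ pos (R v) := by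
    intro u v h
    rcases hR1 u with h1 | h1
    · rw [h1]; have := hself v; omega
    · by_cases h2 : pos v < pos (R u)
      · exact hR2 v _ (Or.inr (humb _ _ _ h h2 h1).2)
      · have := hself v; omega
  have key : ∀ u v, pos u < pos v → (G.Adj u v ↔ pos v ≤ pos (R u)) := by
    intro u v h
    constructor
    · intro h1; exact hR2 u v (Or.inr h1)
    · intro h1
      rcases hR1 u with h2 | h2
      · rw [h2] at h1; omega
      · rcases h1.lt_or_eq with h3 | h3
        · exact (humb _ _ _ h h3 h2).1
        · rw [hinj h3]; exact h2
  have hle : ∀ v, (pos v : ℝ) ≤ pos (R v) + ε v := fun v => by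
    have : (pos v : ℝ) ≤ pos (R v) := by exact_mod_cast hself v
    linarith [e0 v]
  have key2 : ∀ u v, pos u < pos v → (G.Adj u v ↔
      (Set.Icc (pos u : ℝ) (pos (R u) + ε u) ∩ Set.Icc (pos v : ℝ) (pos (R v) + ε v)).Nonempty) := by
    intro u v h
    rw [key u v h]
    constructor
    · intro h1
      refine ⟨pos v, ⟨?_, ?_⟩, le_rfl, hle v⟩
      · exact_mod_cast h.le
      · have : (pos v : ℝ) ≤ pos (R u) := by exact_mod_cast h1
        linarith [e0 u]
    · rintro ⟨t, ⟨_, h1⟩, h2, _⟩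
      have : (pos v : ℝ) < (pos (R u) + 1 : ℕ) := by push_cast; linarith [e1 u]
      have := Nat.cast_lt.1 this
      omega
  refine ⟨fun v => (pos v, pos (R v) + ε v), hle, ?_, ?_⟩
  · intro u v h
    dsimp only at h
    obtain ⟨h1, h2⟩ := Set.ssubset_def ▸ h
    have h3 := (Set.Icc_subset_Icc_iff (hle u)).1 h1
    rcases lt_trichotomy (pos u) (pos v) with h4 | h4 | h4
    · have : (pos u : ℝ) < pos v := by exact_mod_cast h4
      linarith [h3.1]
    · rw [hinj h4] at h2; exact h2 le_rfl
    · have h5 : (pos (R v) : ℝ) ≤ pos (R u) := by exact_mod_cast hRm _ _ h4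
      linarith [h3.2, e2 _ _ h4]
  · intro u v
    dsimp only
    rcases lt_trichotomy (pos u) (pos v) with h4 | h4 | h4
    · rw [key2 u v h4]
      have : u ≠ v := by rintro rfl; omega
      tauto
    · rw [hinj h4]; simp
    · rw [G.adj_comm, key2 v u h4, Set.inter_comm]
      have : u ≠ v := by rintro rfl; omega
      tauto

/-- Layered graph: once the first layers are cliques, all are. -/
theorem layers_clique {V : Type*} (G : SimpleGraph V) (hC : ¬ HasInducedLongCycle G)
    (hC4 : ∀ a b c d, a ≠ c → b ≠ d → G.Adj a b → G.Adj b c → G.Adj c d → G.Adj d a →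
      G.Adj a c ∨ G.Adj b d)
    (hclaw : ¬ HasInducedClaw G) (hnet : ¬ HasInducedNet G)
    (ρ : V → V) (L : V → ℕ)
    (ha : ∀ u v, G.Adj u v → ρ u = ρ v ∧ L u ≤ L v + 1)
    (hb : ∀ v n, L v = n + 1 → ∃ p, G.Adj p v ∧ L p = n)
    (hc : ∀ u v, ρ u = ρ v → u ≠ v → L u = L v → L u ≤ 2 → G.Adj u v) :
    ∀ n u v, ρ u = ρ v → u ≠ v → L u = n → L v = n → G.Adj u v := by
  intro n
  induction n using Nat.strong_induction_on with
  | _ n ih =>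
  intro u v hρ hne hu hv
  by_cases h2 : n ≤ 2
  · exact hc u v hρ hne (by omega) (by omega)
  by_contra hnadj
  obtain ⟨k, rfl⟩ : ∃ k, n = k + 3 := ⟨n - 3, by omega⟩
  -- adjacency forces close layers
  have far : ∀ a b, L a + 2 ≤ L b → ¬ G.Adj a b ∧ ¬ G.Adj b a ∧ a ≠ b := by
    intro a b h
    refine ⟨fun h1 => ?_, fun h1 => ?_, fun h1 => ?_⟩
    · have := (ha _ _ h1.symm).2; omega
    · have := (ha _ _ h1).2; omega
    · subst h1; omega
  have nocommon : ∀ p, G.Adj p u → G.Adj p v → L p = k + 2 → False := by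
    intro p h1 h2 h3
    obtain ⟨q, hq, hq'⟩ := hb p (k+1) h3
    have f1 := far q u (by omega)
    have f2 := far q v (by omega)
    exact hclaw ⟨p, q, u, v, f1.2.2, f2.2.2, hne, hq.symm, h1, h2, f1.1, f2.1, hnadj⟩
  obtain ⟨a, hau, hLa⟩ := hb u (k+2) hu
  obtain ⟨b, hbv, hLb⟩ := hb v (k+2) hv
  have hnav : ¬ G.Adj a v := fun h => nocommon a hau h hLa
  have hnbu : ¬ G.Adj b u := fun h => nocommon b h hbv hLb
  have hab' : a ≠ b := by rintro rfl; exact hnav hbv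
  have hρab : ρ a = ρ b := by rw [(ha _ _ hau).1, (ha _ _ hbv).1, hρ]
  have hab : G.Adj a b := ih (k+2) (by omega) a b hρab hab' hLa hLb
  obtain ⟨c, hca, hcb, hLc⟩ : ∃ c, G.Adj c a ∧ G.Adj c b ∧ L c = k + 1 := by
    obtain ⟨c, hca, hLc⟩ := hb a (k+1) hLa
    obtain ⟨d, hdb, hLd⟩ := hb b (k+1) hLb
    by_cases hcd : c = d
    · subst hcd; exact ⟨c, hca, hdb, hLc⟩
    have hcd' : G.Adj c d := ih (k+1) (by omega) c d
      (by rw [(ha _ _ hca).1, (ha _ _ hdb).1, hρab]) hcd hLc hLd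
    have n1 : c ≠ b := by rintro rfl; omega
    have n2 : a ≠ d := by rintro rfl; omega
    rcases hC4 c a b d n1 n2 hca hab hdb.symm hcd'.symm with h | h
    · exact ⟨c, hca, h, hLc⟩
    · exact ⟨d, h.symm, hdb, hLd⟩
  obtain ⟨d, hdc, hLd⟩ := hb c k hLc
  have f1 := far d a (by omega)
  have f2 := far d b (by omega)
  have f3 := far d u (by omega)
  have f4 := far d v (by omega)
  have f5 := far c u (by omega)
  have f6 := far c v (by omega)
  apply hnet
  have n1 := hca.ne
  have n2 := hcb.ne
  have n3 := hdc.ne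
  have n4 := hau.ne
  have n5 := hbv.ne
  have n6 : a ≠ v := by rintro rfl; omega
  have n7 : b ≠ u := by rintro rfl; omega
  refine ⟨c, a, b, d, u, v, ?_, hca, hab, hcb.symm, hdc, hau.symm, hbv.symm, f1.1, f2.1,
    f5.2.1, fun h => hnbu h.symm, f6.2.1, fun h => hnav h.symm, f3.1, f4.1, hnadj⟩
  simp only [List.nodup_cons, List.mem_cons, List.not_mem_nil, not_or]
  have := f1.2.2
  have := f2.2.2
  have := f3.2.2
  have := f4.2.2
  have := f5.2.2
  have := f6.2.2
  simp [*, Ne.symm n3, Ne.symm f1.2.2, Ne.symm f2.2.2]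

theorem order_of_layers {V : Type*} [Fintype V] (G : SimpleGraph V)
    (hC4 : ∀ a b c d, a ≠ c → b ≠ d → G.Adj a b → G.Adj b c → G.Adj c d → G.Adj d a →
      G.Adj a c ∨ G.Adj b d)
    (hclaw : ¬ HasInducedClaw G)
    (ρ : V → V) (L : V → ℕ)
    (ha : ∀ u v, G.Adj u v → ρ u = ρ v ∧ L u ≤ L v + 1)
    (hc : ∀ u v, ρ u = ρ v → u ≠ v → L u = L v → G.Adj u v) :
    ∃ pos : V → ℕ, Function.Injective pos ∧
    (∀ u v w, pos u < pos v → pos v < pos w → G.Adj u w → G.Adj u v ∧ G.Adj v w) := by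
  classical
  let e := Fintype.equivFin V
  let P : V → Finset V := fun v => Finset.univ.filter fun w => G.Adj v w ∧ L w = L v + 1
  let M : V → Finset V := fun v => Finset.univ.filter fun w => G.Adj v w ∧ L w + 1 = L v
  have hP : ∀ v w, w ∈ P v ↔ G.Adj v w ∧ L w = L v + 1 := fun v w => by simp [P]
  have hM : ∀ v w, w ∈ M v ↔ G.Adj v w ∧ L w + 1 = L v := fun v w => by simp [M]
  have Pcomp : ∀ u v, ρ u = ρ v → L u = L v → P u ⊆ P v ∨ P v ⊆ P u := by
    intro u v h1 h2
    by_contra h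
    rw [not_or, Finset.not_subset, Finset.not_subset] at h
    obtain ⟨⟨a, ha1, ha2⟩, b, hb1, hb2⟩ := h
    rw [hP] at ha1 ha2 hb1 hb2
    have huv : u ≠ v := by rintro rfl; exact ha2 ha1
    have hab : a ≠ b := by rintro rfl; exact ha2 hb1
    have c1 := hc u v h1 huv h2
    have c2 := hc a b (by rw [← (ha _ _ ha1.1).1, ← (ha _ _ hb1.1).1, h1]) hab (by omega)
    rcases hC4 u v b a (by rintro rfl; omega) (by rintro rfl; omega) c1 hb1.1 c2.symm ha1.1.symm
      with h | h
    · exact hb2 ⟨h, by omega⟩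
    · exact ha2 ⟨h, by omega⟩
  have Mcomp : ∀ u v, ρ u = ρ v → L u = L v → M u ⊆ M v ∨ M v ⊆ M u := by
    intro u v h1 h2
    by_contra h
    rw [not_or, Finset.not_subset, Finset.not_subset] at h
    obtain ⟨⟨a, ha1, ha2⟩, b, hb1, hb2⟩ := h
    rw [hM] at ha1 ha2 hb1 hb2
    have huv : u ≠ v := by rintro rfl; exact ha2 ha1
    have hab : a ≠ b := by rintro rfl; exact ha2 hb1
    have c1 := hc u v h1 huv h2
    have c2 := hc a b (by rw [← (ha _ _ ha1.1).1, ← (ha _ _ hb1.1).1, h1]) hab (by omega)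
    rcases hC4 u v b a (by rintro rfl; omega) (by rintro rfl; omega) c1 hb1.1 c2.symm ha1.1.symm
      with h | h
    · exact hb2 ⟨h, by omega⟩
    · exact ha2 ⟨h, by omega⟩
  have compat : ∀ u v, ρ u = ρ v → L u = L v → ¬ P v ⊆ P u → ¬ M v ⊆ M u → False := by
    intro u v h1 h2 h3 h4
    rw [Finset.not_subset] at h3 h4
    obtain ⟨a, ha1, ha2⟩ := h3
    obtain ⟨b, hb1, hb2⟩ := h4
    rw [hP] at ha1 ha2
    rw [hM] at hb1 hb2
    have huv : u ≠ v := by rintro rfl; exact ha2 ha1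
    have c1 := hc u v h1 huv h2
    refine hclaw ⟨v, u, a, b, by rintro rfl; omega, by rintro rfl; omega, by rintro rfl; omega,
      c1.symm, ha1.1, hb1.1, fun h => ha2 ⟨h, by omega⟩, fun h => hb2 ⟨h, by omega⟩, fun h => ?_⟩
    have := (ha _ _ h).2
    omega
  let k : V → ℤ := fun v => (P v).card - (M v).card
  have keyP : ∀ u v, ρ u = ρ v → L u = L v → k u ≤ k v → P u ⊆ P v := by
    intro u v h1 h2 h3
    by_contra h
    have h4 : P v ⊆ P u := (Pcomp u v h1 h2).resolve_left h
    have h5 : M u ⊆ M v := by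
      by_contra h6
      exact compat v u h1.symm h2.symm h h6
    have h6 := Finset.card_lt_card (Finset.ssubset_def.2 ⟨h4, h⟩)
    have h7 := Finset.card_le_card h5
    simp only [k] at h3
    omega
  have keyM : ∀ u v, ρ u = ρ v → L u = L v → k u ≤ k v → M v ⊆ M u := by
    intro u v h1 h2 h3
    by_contra h
    have h4 : M u ⊆ M v := (Mcomp u v h1 h2).resolve_right h
    have h5 : P v ⊆ P u := by
      by_contra h6
      exact compat u v h1 h2 h6 h
    have h6 := Finset.card_lt_card (Finset.ssubset_def.2 ⟨h4, h⟩)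
    have h7 := Finset.card_le_card h5
    simp only [k] at h3
    omega
  let K : V → ℕ ×ₗ ℕ ×ₗ ℤ ×ₗ ℕ := fun v =>
    toLex ((e (ρ v) : ℕ), toLex (L v, toLex (k v, (e v : ℕ))))
  have Kinj : Function.Injective K := by
    intro u v h
    simp only [K, EmbeddingLike.apply_eq_iff_eq, Prod.mk.injEq, Fin.val_inj] at h
    exact h.2.2.2
  have Klt : ∀ u v, K u < K v → (e (ρ u) : ℕ) < e (ρ v) ∨ (ρ u = ρ v ∧
      (L u < L v ∨ (L u = L v ∧ k u ≤ k v))) := by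
    intro u v h
    simp only [K, Prod.Lex.toLex_lt_toLex, Fin.val_inj, EmbeddingLike.apply_eq_iff_eq] at h
    rcases h with h | ⟨g, h | ⟨h', h | h⟩⟩
    · exact Or.inl h
    · exact Or.inr ⟨g, Or.inl h⟩
    · exact Or.inr ⟨g, Or.inr ⟨h', h.le⟩⟩
    · exact Or.inr ⟨g, Or.inr ⟨h', h.1.le⟩⟩
  have main : ∀ u v w, K u < K v → K v < K w → G.Adj u w → G.Adj u v ∧ G.Adj v w := by
    intro u v w h1 h2 h3
    have nuv : u ≠ v := by rintro rfl; exact lt_irrefl _ h1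
    have nvw : v ≠ w := by rintro rfl; exact lt_irrefl _ h2
    obtain ⟨r1, l1⟩ := ha _ _ h3
    have l2 := (ha _ _ h3.symm).2
    have k1 := Klt _ _ h1
    have k2 := Klt _ _ h2
    rw [r1] at k1
    have k1' : ρ u = ρ v := by
      rcases k1 with k1 | k1
      · rcases k2 with k2 | k2
        · omega
        · rw [k2.1] at k1; omega
      · rw [r1, k1.1]
    have k2' : ρ v = ρ w := by rw [← k1', r1]
    rw [k2'] at k1 k2
    have k1 := (k1.resolve_left (lt_irrefl _)).2
    have k2 := (k2.resolve_left (lt_irrefl _)).2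
    rcases k1 with k1 | ⟨k1, k1k⟩
    · rcases k2 with k2 | ⟨k2, k2k⟩
      · omega
      · refine ⟨?_, hc _ _ k2' nvw k2⟩
        have := keyM v w k2' k2 k2k ((hM _ _).2 ⟨h3.symm, by omega⟩)
        exact ((hM _ _).1 this).1.symm
    · rcases k2 with k2 | ⟨k2, k2k⟩
      · refine ⟨hc _ _ k1' nuv k1, ?_⟩
        have := keyP u v k1' k1 k1k ((hP _ _).2 ⟨h3, by omega⟩)
        exact ((hP _ _).1 this).1
      · exact ⟨hc _ _ k1' nuv k1, hc _ _ k2' nvw k2⟩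
  let pos : V → ℕ := fun v => (Finset.univ.filter fun w => K w < K v).card
  have pmono : ∀ u v, K u < K v → pos u < pos v := by
    intro u v h
    apply Finset.card_lt_card
    rw [Finset.ssubset_iff_of_subset]
    · exact ⟨u, by simpa using h, by simp⟩
    · intro w hw
      simp only [Finset.mem_filter, Finset.mem_univ, true_and] at hw ⊢
      exact hw.trans h
  have pmono' : ∀ u v, pos u < pos v → K u < K v := by
    intro u v h
    rcases lt_trichotomy (K u) (K v) with h1 | h1 | h1
    · exact h1
    · rw [Kinj h1] at h; omega
    · have := pmono _ _ h1; omega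
  refine ⟨pos, ?_, fun u v w h1 h2 => main u v w (pmono' _ _ h1) (pmono' _ _ h2)⟩
  intro u v h
  rcases lt_trichotomy (K u) (K v) with h1 | h1 | h1
  · have := pmono _ _ h1; omega
  · exact Kinj h1
  · have := pmono _ _ h1; omega

theorem cycle_of_seq {V : Type*} (G : SimpleGraph V) (m : ℕ) (hm : 4 ≤ m) (c : ℕ → V)
    (h : ∀ i j, i < j → j < m → c i ≠ c j ∧ (G.Adj (c i) (c j) ↔ j = i + 1 ∨ (i = 0 ∧ j + 1 = m))) :
    HasInducedLongCycle G := by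
  have : NeZero m := ⟨by omega⟩
  have : Fact (1 < m) := ⟨by omega⟩
  have hval : ∀ i j : ZMod m, j = i + 1 ↔ (j.val = i.val + 1 ∨ (j.val = 0 ∧ i.val + 1 = m)) := by
    intro i j
    have hi := ZMod.val_lt i
    have hj := ZMod.val_lt j
    rw [← (ZMod.val_injective m).eq_iff, ZMod.val_add, ZMod.val_one]
    by_cases h : i.val + 1 = m
    · rw [h, Nat.mod_self]; omega
    · rw [Nat.mod_eq_of_lt (by omega)]; omega
  refine ⟨m, hm, fun z => c z.val, ?_, ?_⟩
  · intro a b hab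
    apply ZMod.val_injective m
    rcases lt_trichotomy a.val b.val with h1 | h1 | h1
    · exact absurd hab (h _ _ h1 (ZMod.val_lt b)).1
    · exact h1
    · exact absurd hab.symm (h _ _ h1 (ZMod.val_lt a)).1
  · intro a b
    rw [hval, hval]
    have := ZMod.val_lt a
    have := ZMod.val_lt b
    rcases lt_trichotomy a.val b.val with h1 | h1 | h1
    · rw [(h _ _ h1 (ZMod.val_lt b)).2]; omega
    · dsimp only
      rw [h1]
      simp only [SimpleGraph.irrefl, false_iff]; omega
    · rw [G.adj_comm, (h _ _ h1 (ZMod.val_lt a)).2]; omega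

theorem c4_of_nocycle {V : Type*} (G : SimpleGraph V) (hC : ¬ HasInducedLongCycle G) :
    ∀ a b c d, a ≠ c → b ≠ d → G.Adj a b → G.Adj b c → G.Adj c d → G.Adj d a →
      G.Adj a c ∨ G.Adj b d := by
  intro a b c d n1 n2 h1 h2 h3 h4
  by_contra h
  rw [not_or] at h
  apply hC
  apply cycle_of_seq G 4 le_rfl
    (fun i => if i = 0 then a else if i = 1 then b else if i = 2 then c else d)
  intro i j hij hj
  have e1 := h1.ne
  have e2 := h2.ne
  have e3 := h3.ne
  have e4 := h4.ne'
  have : (i = 0 ∧ j = 1) ∨ (i = 0 ∧ j = 2) ∨ (i = 0 ∧ j = 3) ∨ (i = 1 ∧ j = 2) ∨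
    (i = 1 ∧ j = 3) ∨ (i = 2 ∧ j = 3) := by omega
  rcases this with ⟨rfl, rfl⟩ | ⟨rfl, rfl⟩ | ⟨rfl, rfl⟩ | ⟨rfl, rfl⟩ | ⟨rfl, rfl⟩ | ⟨rfl, rfl⟩ <;>
    simp [*, h4.symm]

/-- Induced path from `x` to `y` through the connected set `C`. -/
theorem induced_path {V : Type*} (G : SimpleGraph V) (C : Set V) (x y u v : V)
    (hx : x ∉ C) (hy : y ∉ C) (hxy : x ≠ y)
    (hu : u ∈ C) (hxu : G.Adj x u) (hv : v ∈ C) (hvy : G.Adj v y)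
    (huv : Relation.ReflTransGen (fun a b => G.Adj a b ∧ a ∈ C ∧ b ∈ C) u v) :
    ∃ (n : ℕ) (q : ℕ → V), 2 ≤ n ∧ q 0 = x ∧ q n = y ∧ (∀ i, 0 < i → i < n → q i ∈ C) ∧
      ∀ i j, i < j → j ≤ n → q i ≠ q j ∧
        (¬ (i = 0 ∧ j = n) → (G.Adj (q i) (q j) ↔ j = i + 1)) := by
  classical
  let T : ℕ → Prop := fun n => ∃ q : ℕ → V, 2 ≤ n ∧ q 0 = x ∧ q n = y ∧
    (∀ i, 0 < i → i < n → q i ∈ C) ∧ ∀ i, i < n → G.Adj (q i) (q (i+1))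
  have hT : ∃ n, T n := by
    have h1 : ∃ (n : ℕ) (q : ℕ → V), 1 ≤ n ∧ q 0 = x ∧ q n = v ∧
        (∀ i, 0 < i → i ≤ n → q i ∈ C) ∧ ∀ i, i < n → G.Adj (q i) (q (i+1)) := by
      clear hvy hv
      induction huv with
      | refl =>
        refine ⟨1, fun i => if i = 0 then x else u, le_rfl, by simp, by simp, ?_, ?_⟩
        · intro i h1 h2; simp [h1.ne', hu]
        · intro i h1
          obtain rfl : i = 0 := by omega
          simpa using hxu
      | @tail b c _ h ih =>
        obtain ⟨n, q, h1, h2, h3, h4, h5⟩ := ih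
        refine ⟨n+1, fun i => if i ≤ n then q i else c, by omega, by simpa using h2, by simp,
          ?_, ?_⟩
        · intro i hi1 hi2
          dsimp only
          split_ifs with h6
          · exact h4 i hi1 h6
          · exact h.2.2
        · intro i hi
          dsimp only
          rw [if_pos (by omega)]
          split_ifs with h6
          · exact h5 i (by omega)
          · obtain rfl : i = n := by omega
            rw [h3]; exact h.1
    obtain ⟨n, q, h1, h2, h3, h4, h5⟩ := h1
    refine ⟨n+1, fun i => if i ≤ n then q i else y, by omega, by simpa using h2, by simp, ?_, ?_⟩
    · intro i hi1 hi2
      dsimp only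
      rw [if_pos (by omega)]
      exact h4 i hi1 (by omega)
    · intro i hi
      dsimp only
      rw [if_pos (by omega)]
      split_ifs with h6
      · exact h5 i (by omega)
      · obtain rfl : i = n := by omega
        rw [h3]; exact hvy
  obtain ⟨q, h2, q0, qn, qC, qa⟩ := Nat.find_spec hT
  have hmin : ∀ k, k < Nat.find hT → ¬ T k := fun k hk => Nat.find_min hT hk
  generalize Nat.find hT = n at *
  have short : ∀ i j, i + 1 < j → j ≤ n → ¬ (i = 0 ∧ j = n) → ¬ G.Adj (q i) (q j) := by
    intro i j hij hj hne hadj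
    refine hmin (i + 1 + (n - j)) (by omega)
      ⟨fun k => if k ≤ i then q k else q (k + (j - i - 1)), by omega, by simpa using q0, ?_, ?_, ?_⟩
    · dsimp only
      rw [if_neg (by omega), ← qn]
      congr 1; omega
    · intro k hk1 hk2
      dsimp only
      split_ifs with h
      · exact qC k hk1 (by omega)
      · exact qC _ (by omega) (by omega)
    · intro k hk
      dsimp only
      split_ifs with h h' h'
      · exact qa k (by omega)
      · obtain rfl : k = i := by omega
        rw [show k + 1 + (j - k - 1) = j by omega]
        exact hadj
      · omega
      · rw [show k + 1 + (j - i - 1) = k + (j - i - 1) + 1 by omega]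
        exact qa _ (by omega)
  refine ⟨n, q, h2, q0, qn, qC, ?_⟩
  intro i j hij hj
  constructor
  · intro heq
    by_cases hjn : j = n
    · subst hjn
      by_cases hi : i = 0
      · subst hi; exact hxy (by rw [← q0, ← qn, heq])
      · exact hy (by rw [← qn, ← heq]; exact qC i (by omega) (by omega))
    · by_cases hi : i = 0
      · subst hi; exact hx (by rw [← q0, heq]; exact qC j (by omega) (by omega))
      · refine short i (j+1) (by omega) (by omega) (by omega) ?_
        rw [heq]; exact qa j (by omega)
  · intro hne
    constructor
    · intro h
      by_contra h'
      exact short i j (by omega) hj hne h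
    · rintro rfl
      exact qa i (by omega)

theorem common_nbr {V : Type*} (G : SimpleGraph V) (hC : ¬ HasInducedLongCycle G)
    (C : Set V) (x y u v : V)
    (hx : x ∉ C) (hy : y ∉ C) (hxy : G.Adj x y)
    (hu : u ∈ C) (hxu : G.Adj x u) (hv : v ∈ C) (hvy : G.Adj v y)
    (huv : Relation.ReflTransGen (fun a b => G.Adj a b ∧ a ∈ C ∧ b ∈ C) u v) :
    ∃ m ∈ C, G.Adj x m ∧ G.Adj y m := by
  obtain ⟨n, q, h2, q0, qn, qC, qa⟩ := induced_path G C x y u v hx hy hxy.ne hu hxu hv hvy huv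
  by_cases hn : n = 2
  · subst hn
    refine ⟨q 1, qC 1 (by omega) (by omega), ?_, ?_⟩
    · rw [← q0]; exact ((qa 0 1 (by omega) (by omega)).2 (by omega)).2 rfl
    · rw [← qn]; exact (((qa 1 2 (by omega) (by omega)).2 (by omega)).2 rfl).symm
  · exfalso
    apply hC
    apply cycle_of_seq G (n+1) (by omega) q
    intro i j hij hj
    refine ⟨(qa i j hij (by omega)).1, ?_⟩
    by_cases h : i = 0 ∧ j = n
    · obtain ⟨rfl, rfl⟩ := h
      rw [q0, qn]
      simp [hxy]
    · rw [(qa i j hij (by omega)).2 h]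
      omega

theorem sep_clique {V : Type*} (G : SimpleGraph V) (hC : ¬ HasInducedLongCycle G)
    (C : Set V) (s x y u v : V)
    (hx : x ∉ C) (hy : y ∉ C) (hxy : x ≠ y) (hs : s ∉ C) (hsC : ∀ c ∈ C, ¬ G.Adj c s)
    (hsx : G.Adj s x) (hsy : G.Adj s y)
    (hu : u ∈ C) (hxu : G.Adj x u) (hv : v ∈ C) (hvy : G.Adj v y)
    (huv : Relation.ReflTransGen (fun a b => G.Adj a b ∧ a ∈ C ∧ b ∈ C) u v) :
    G.Adj x y := by
  by_contra hn
  obtain ⟨n, q, h2, q0, qn, qC, qa⟩ := induced_path G C x y u v hx hy hxy hu hxu hv hvy huv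
  apply hC
  apply cycle_of_seq G (n+2) (by omega) (fun i => if i ≤ n then q i else s)
  intro i j hij hj
  rw [if_pos (by omega : i ≤ n)]
  by_cases hjn : j ≤ n
  · rw [if_pos hjn]
    refine ⟨(qa i j hij (by omega)).1, ?_⟩
    by_cases h : i = 0 ∧ j = n
    · obtain ⟨rfl, rfl⟩ := h
      rw [q0, qn]
      simp only [hn, false_iff]
      omega
    · rw [(qa i j hij (by omega)).2 h]
      omega
  · rw [if_neg hjn]
    by_cases hi : i = 0
    · subst hi
      rw [q0]
      refine ⟨hsx.ne', ?_⟩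
      exact iff_of_true hsx.symm (by omega)
    · by_cases hi' : i = n
      · subst hi'
        rw [qn]
        refine ⟨hsy.ne', ?_⟩
        exact iff_of_true hsy.symm (by omega)
      · have hq := qC i (by omega) (by omega)
        refine ⟨fun h => hs (h ▸ hq), ?_⟩
        exact iff_of_false (hsC _ hq) (by omega)

/-- The component of `c` in `G - N[s]`. -/
def compOf {V : Type*} (G : SimpleGraph V) (s c : V) : Set V :=
  {v | Relation.ReflTransGen (fun a b => G.Adj a b ∧ b ≠ s ∧ ¬ G.Adj s b) c v}

theorem compOf_conn {V : Type*} (G : SimpleGraph V) (s c : V) (v : V) (hv : v ∈ compOf G s c) :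
    Relation.ReflTransGen (fun a b => G.Adj a b ∧ a ∈ compOf G s c ∧ b ∈ compOf G s c) c v := by
  induction hv with
  | refl => exact .refl
  | tail h1 h2 ih => exact ih.tail ⟨h2.1, h1, h1.tail h2⟩

theorem compOf_conn2 {V : Type*} (G : SimpleGraph V) (s c : V) (u v : V) (hu : u ∈ compOf G s c)
    (hv : v ∈ compOf G s c) :
    Relation.ReflTransGen (fun a b => G.Adj a b ∧ a ∈ compOf G s c ∧ b ∈ compOf G s c) u v := by
  refine Relation.ReflTransGen.trans ?_ (compOf_conn G s c v hv)
  have : Std.Symm (fun a b => G.Adj a b ∧ a ∈ compOf G s c ∧ b ∈ compOf G s c) :=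
    ⟨fun a b h => ⟨h.1.symm, h.2.2, h.2.1⟩⟩
  exact Relation.ReflTransGen.stdSymm.symm _ _ (compOf_conn G s c u hu)

theorem compOf_mono {V : Type*} (G : SimpleGraph V) (s c d : V)
    (hd : ∀ v ∈ compOf G s c, v ≠ d ∧ ¬ G.Adj d v) : compOf G s c ⊆ compOf G d c := by
  intro v hv
  induction hv with
  | refl => exact .refl
  | tail h1 h2 ih => exact ih.tail ⟨h2.1, hd _ (h1.tail h2)⟩

theorem exists_boundary {V : Type*} (G : SimpleGraph V) (C : Set V) {s c : V} (w : G.Walk s c)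
    (hs : s ∉ C) (hc : c ∈ C) : ∃ z v, z ∉ C ∧ v ∈ C ∧ G.Adj z v := by
  induction w with
  | nil => exact absurd hc hs
  | @cons a b e h p ih =>
    by_cases hb : b ∈ C
    · exact ⟨a, b, hs, hb, h⟩
    · exact ih hb hc

theorem exists_end {V : Type*} [Fintype V] (G : SimpleGraph V) (hC : ¬ HasInducedLongCycle G)
    (hclaw : ¬ HasInducedClaw G) (htent : ¬ HasInducedTent G) (r : V) :
    ∃ s, G.Reachable r s ∧ (∀ u v, G.Adj s u → G.Adj s v → u ≠ v → G.Adj u v) ∧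
      (∀ a b x y, G.Adj s x → G.Adj s y → G.Adj x a → G.Adj y b → ¬ G.Adj s a → ¬ G.Adj s b →
        a ≠ s → b ≠ s → a ≠ b → G.Adj a b) := by
  classical
  by_cases hcomp : ∃ p : V × V, G.Reachable r p.1 ∧ G.Reachable r p.2 ∧ p.2 ≠ p.1 ∧ ¬ G.Adj p.1 p.2
  swap
  · push Not at hcomp
    refine ⟨r, .refl _, ?_, ?_⟩
    · intro u v hu hv huv
      exact hcomp (u, v) hu.reachable hv.reachable huv.symm
    · intro a b x y hx hy hxa hyb ha hb nar nbr nab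
      exact absurd (hcomp (r, a) (.refl _) (hx.reachable.trans hxa.reachable) nar) ha
  obtain ⟨⟨s, c⟩, hp, hmax⟩ := Set.exists_max_image
    {p : V × V | G.Reachable r p.1 ∧ G.Reachable r p.2 ∧ p.2 ≠ p.1 ∧ ¬ G.Adj p.1 p.2}
    (fun p => (compOf G p.1 p.2).ncard) (Set.toFinite _) hcomp
  obtain ⟨hrs, hrc, hcs, hsc⟩ := hp
  dsimp only at hrs hrc hcs hsc hmax
  have hcC : c ∈ compOf G s c := Relation.ReflTransGen.refl
  have hCs : ∀ v ∈ compOf G s c, v ≠ s ∧ ¬ G.Adj s v := by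
    intro v hv
    rcases Relation.ReflTransGen.cases_tail hv with h | ⟨w, _, h⟩
    · subst h; exact ⟨hcs, hsc⟩
    · exact h.2
  have hclosed : ∀ d v w, v ∈ compOf G d c → G.Adj v w → w ≠ d → ¬ G.Adj d w → w ∈ compOf G d c :=
    fun d v w hv h1 h2 h3 => Relation.ReflTransGen.tail hv ⟨h1, h2, h3⟩
  have hconn := compOf_conn2 G s c
  have hD : ∀ d, G.Reachable r d → (∀ v ∈ compOf G s c, v ≠ d ∧ ¬ G.Adj d v) →
      compOf G d c = compOf G s c := by
    intro d hd hdC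
    have h1 := hmax (d, c) ⟨hd, hrc, hdC c hcC⟩
    exact (Set.eq_of_subset_of_ncard_le (compOf_mono G s c d hdC) h1 (Set.toFinite _)).symm
  generalize compOf G s c = C at *
  -- boundary vertices are adjacent to every far vertex
  have hDS : ∀ d, G.Reachable r d → (∀ v ∈ C, v ≠ d ∧ ¬ G.Adj d v) →
      ∀ x v, x ∉ C → v ∈ C → G.Adj x v → G.Adj d x := by
    intro d hd hdC x v hx hv hxv
    by_contra h
    have h1 := hD d hd hdC
    refine hx ?_
    rw [← h1]
    refine hclosed d v x (h1 ▸ hv) hxv.symm ?_ h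
    rintro rfl
    exact (hdC v hv).2 hxv
  -- some boundary vertex exists
  obtain ⟨z, v0, hz, hv0, hzv0⟩ : ∃ z v, z ∉ C ∧ v ∈ C ∧ G.Adj z v := by
    have hsC : s ∉ C := fun h => (hCs s h).1 rfl
    obtain ⟨w⟩ := hrs.symm.trans hrc
    exact exists_boundary G C w hsC hcC
  have hDclique : ∀ d d', G.Reachable r d → (∀ v ∈ C, v ≠ d ∧ ¬ G.Adj d v) →
      G.Reachable r d' → (∀ v ∈ C, v ≠ d' ∧ ¬ G.Adj d' v) → d ≠ d' → G.Adj d d' := by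
    intro d d' h1 h2 h3 h4 h5
    by_contra h
    have e1 := hDS d h1 h2 z v0 hz hv0 hzv0
    have e2 := hDS d' h3 h4 z v0 hz hv0 hzv0
    exact hclaw ⟨z, d, d', v0, h5, (h2 v0 hv0).1.symm, (h4 v0 hv0).1.symm, e1.symm, e2.symm, hzv0,
      h, (h2 v0 hv0).2, (h4 v0 hv0).2⟩
  have hsC : s ∉ C := fun h => (hCs s h).1 rfl
  have hdich : ∀ x, x ∉ C → (∃ v ∈ C, G.Adj x v) ∨ (∀ v ∈ C, v ≠ x ∧ ¬ G.Adj x v) := by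
    intro x hx
    by_cases h : ∃ v ∈ C, G.Adj x v
    · exact Or.inl h
    · push Not at h
      exact Or.inr fun v hv => ⟨fun h' => hx (h' ▸ hv), h v hv⟩
  have hNsC : ∀ x, G.Adj s x → x ∉ C := fun x h h' => (hCs x h').2 h
  refine ⟨s, hrs, ?_, ?_⟩
  · intro u v hu hv huv
    have ru : G.Reachable r u := hrs.trans hu.reachable
    have rv : G.Reachable r v := hrs.trans hv.reachable
    rcases hdich u (hNsC u hu) with ⟨u', h1, h1'⟩ | h1
    · rcases hdich v (hNsC v hv) with ⟨v', h2, h2'⟩ | h2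
      · exact sep_clique G hC C s u v u' v' (hNsC u hu) (hNsC v hv) huv hsC
          (fun c hc h => (hCs c hc).2 h.symm) hu hv h1 h1' h2 h2'.symm (hconn _ _ h1 h2)
      · exact (hDS v rv h2 u u' (hNsC u hu) h1 h1').symm
    · rcases hdich v (hNsC v hv) with ⟨v', h2, h2'⟩ | h2
      · exact hDS u ru h1 v v' (hNsC v hv) h2 h2'
      · exact hDclique u v ru h1 rv h2 huv
  · have hL2 : ∀ a x, G.Adj s x → G.Adj x a → ¬ G.Adj s a → a ≠ s → a ∈ C := by
      intro a x hx hxa hsa has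
      by_contra haC
      rcases hdich a haC with ⟨a', h1, h1'⟩ | h1
      · exact hsa (hDS s hrs hCs a a' haC h1 h1')
      · exact hsa (hDclique s a hrs hCs (hrs.trans (hx.reachable.trans hxa.reachable)) h1 has.symm)
    intro a b x y hsx hsy hxa hyb hsa hsb has hbs hab
    by_contra hnab
    have haC := hL2 a x hsx hxa hsa has
    have hbC := hL2 b y hsy hyb hsb hbs
    have hxC := hNsC x hsx
    have hyC := hNsC y hsy
    -- neighbours in C of a neighbour of s form a clique
    have hcl : ∀ x, G.Adj s x → ∀ p ∈ C, ∀ q ∈ C, G.Adj x p → G.Adj x q → p ≠ q → G.Adj p q := by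
      intro x hx p hp q hq h1 h2 h3
      by_contra h
      exact hclaw ⟨x, s, p, q, (hCs p hp).1.symm, (hCs q hq).1.symm, h3, hx.symm, h1, h2,
        (hCs p hp).2, (hCs q hq).2, h⟩
    have hxb : ¬ G.Adj x b := fun h => hnab (hcl x hsx a haC b hbC hxa h hab)
    have hya : ¬ G.Adj y a := fun h => hnab (hcl y hsy a haC b hbC h hyb hab)
    have hxy' : x ≠ y := by rintro rfl; exact hxb hyb
    have hxy : G.Adj x y := sep_clique G hC C s x y a b hxC hyC hxy' hsC
          (fun c hc h => (hCs c hc).2 h.symm) hsx hsy haC hxa hbC hyb.symm (hconn _ _ haC hbC)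
    obtain ⟨m, hm, hxm, hym⟩ := common_nbr G hC C x y a b hxC hyC hxy haC hxa hbC hyb.symm
      (hconn _ _ haC hbC)
    have hma' : m ≠ a := by rintro rfl; exact hya hym
    have hmb' : m ≠ b := by rintro rfl; exact hxb hxm
    have hma := hcl x hsx m hm a haC hxm hxa hma'
    have hmb := hcl y hsy m hm b hbC hym hyb hmb'
    apply htent
    have n1 := hxy.ne
    have n2 := hxm.ne
    have n3 := hym.ne
    have n4 := hsx.ne
    have n5 := hsy.ne
    have n6 := (hCs m hm).1
    have n7 := hxa.ne
    have n8 := hyb.ne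
    have n9 : x ≠ b := by rintro rfl; exact hxC hbC
    have n10 : y ≠ a := by rintro rfl; exact hyC haC
    refine ⟨x, y, m, b, a, s, ?_, hxy, hym, hxm.symm, hyb.symm, hmb.symm, hxa.symm, hma.symm,
      hsx, hsy, fun h => hxb h.symm, fun h => hya h.symm, (hCs m hm).2, fun h => hnab h.symm,
      fun h => hsb h.symm, fun h => hsa h.symm⟩
    simp only [List.nodup_cons, List.mem_cons, List.not_mem_nil, not_or]
    simp [*, Ne.symm n4, Ne.symm n5, Ne.symm hab]

theorem walk_first {V : Type*} (G : SimpleGraph V) {a b : V} (w : G.Walk a b) (n : ℕ)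
    (h : w.length = n + 1) : ∃ (p : V) (q : G.Walk p b), G.Adj a p ∧ q.length = n := by
  cases w with
  | nil => simp at h
  | cons h' q => exact ⟨_, q, h', by simpa using h⟩

theorem pig_backward {V : Type*} [Fintype V] (G : SimpleGraph V) (hC : ¬ HasInducedLongCycle G)
    (hclaw : ¬ HasInducedClaw G) (hnet : ¬ HasInducedNet G) (htent : ¬ HasInducedTent G) :
    IsProperIntervalGraph G := by
  have hC4 := c4_of_nocycle G hC
  have hend := fun K : G.ConnectedComponent => exists_end G hC hclaw htent K.out
  choose S hS1 hS2 hS3 using hend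
  have hreach : ∀ v, G.Reachable (S (G.connectedComponentMk v)) v := by
    intro v
    refine (hS1 _).symm.trans ?_
    apply SimpleGraph.ConnectedComponent.exact
    exact Quot.out_eq _
  have hadjc : ∀ u v, G.Adj u v → G.connectedComponentMk u = G.connectedComponentMk v :=
    fun u v h => SimpleGraph.ConnectedComponent.sound h.reachable
  let ρ : V → V := fun v => S (G.connectedComponentMk v)
  let L : V → ℕ := fun v => G.dist (ρ v) v
  have ha : ∀ u v, G.Adj u v → ρ u = ρ v ∧ L u ≤ L v + 1 := by
    intro u v h
    have h1 : ρ u = ρ v := by simp only [ρ, hadjc u v h]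
    refine ⟨h1, ?_⟩
    simp only [L, h1]
    obtain ⟨w, hw⟩ := (hreach v).exists_walk_length_eq_dist
    have := SimpleGraph.dist_le (w.concat h.symm)
    rw [SimpleGraph.Walk.length_concat, hw] at this
    exact this
  have hb : ∀ v n, L v = n + 1 → ∃ p, G.Adj p v ∧ L p = n := by
    intro v n h
    obtain ⟨w, hw⟩ := (hreach v).exists_walk_length_eq_dist
    obtain ⟨p, q, hp, hq⟩ : ∃ (p : V) (q : G.Walk (ρ v) p), G.Adj p v ∧ q.length = n := by
      obtain ⟨p, q, hp, hq⟩ := walk_first G w.reverse n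
        (by rw [SimpleGraph.Walk.length_reverse, hw]; exact h)
      exact ⟨p, q.reverse, hp.symm, by simpa using hq⟩
    refine ⟨p, hp, ?_⟩
    have h1 := (ha v p hp.symm)
    have h2 : L p ≤ n := by
      simp only [L, ← h1.1]
      rw [← hq]
      exact SimpleGraph.dist_le q
    omega
  have h0 : ∀ v, L v = 0 → v = ρ v := fun v h => ((hreach v).dist_eq_zero_iff.1 h).symm
  have h1 : ∀ v, L v = 1 → G.Adj (ρ v) v := fun v h => SimpleGraph.dist_eq_one_iff_adj.1 h
  have hc : ∀ u v, ρ u = ρ v → u ≠ v → L u = L v → L u ≤ 2 → G.Adj u v := by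
    intro u v hρ hne hL h2
    have hcase : L u = 0 ∨ L u = 1 ∨ L u = 2 := by omega
    rcases hcase with h | h | h
    · exact absurd (by rw [h0 u h, h0 v (by omega), hρ]) hne
    · refine hS2 (G.connectedComponentMk u) u v (h1 u h) ?_ hne
      change G.Adj (ρ u) v
      rw [hρ]; exact h1 v (by omega)
    · obtain ⟨x, hx, hLx⟩ := hb u 1 h
      obtain ⟨y, hy, hLy⟩ := hb v 1 (by omega)
      have ex := (ha _ _ hx).1
      have ey := (ha _ _ hy).1
      have lu : ∀ w, L w = 2 → ¬ G.Adj (ρ w) w ∧ w ≠ ρ w := by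
        intro w hw
        constructor
        · intro h'
          have := SimpleGraph.dist_eq_one_iff_adj.2 h'
          change L w = 1 at this
          omega
        · intro h'
          have : L w = 0 := by
            change G.dist (ρ w) w = 0
            rw [← h']; simp
          omega
      have l1 := lu u h
      have l2 := lu v (by omega)
      have g1 := h1 x hLx
      have g2 := h1 y hLy
      rw [ex] at g1
      rw [ey, ← hρ] at g2
      rw [← hρ] at l2
      exact hS3 (G.connectedComponentMk u) u v x y g1 g2 hx hy l1.1 l2.1 l1.2 l2.2 hne
  have hall := layers_clique G hC hC4 hclaw hnet ρ L ha hb hc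
  obtain ⟨pos, p1, p2⟩ := order_of_layers G hC4 hclaw ρ L ha
    (fun u v h1 h2 h3 => hall (L u) u v h1 h2 rfl h3.symm)
  exact pig_of_order G pos p1 p2

/-- A graph is a proper interval graph iff it contains no induced
cycle of length at least four, no induced claw, no induced net, and no induced
tent. -/
theorem stmt17 {V : Type*} [Fintype V] (G : SimpleGraph V) :
    IsProperIntervalGraph G ↔
      ¬ HasInducedLongCycle G ∧ ¬ HasInducedClaw G ∧ ¬ HasInducedNet G ∧
      ¬ HasInducedTent G := by
  exact ⟨pig_forward G, fun h => pig_backward G h.1 h.2.1 h.2.2.1 h.2.2.2⟩
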